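/- Let $\lambda_b > 0$, $0 < f < 1$, $R_b > 0$, $R_s > 0$, and set $T_1 = \lambda_b/R_b$, $T_2 = \lambda_b/R_s$. Let $J(x, s) = (1 - e^{-T_1 x})(1 - e^{-T_2(s - x)})$ for $0 \le x \le s$ and $J(x, s) = 1 - e^{-T_2(x - s)}$ for $x > s$, and let $f_{nn}(y \mid x) = \lambda_b e^{-\lambda_b y}$ for $0 \le y < 2x$ and $f_{nn}(y \mid x) = 2\lambda_b e^{-2\lambda_b(y - x)}$ for $y \ge 2x$. Then $\int_0^\infty \Big( \int_0^\infty J\big(x, \tfrac{f y}{2}\big)\, f_{nn}(y \mid x)\, dy \Big)\, 2\lambda_b e^{-2\lambda_b x}\, dx = \frac{(f-1)(f-2)}{2(4 R_s + 1 - f)} + \frac{f^3}{2(4 R_b + f)(4 R_s + f)} + \frac{2 R_s}{(4 R_s + 1 - f)(2 R_s + 1)}$. -/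

import Mathlib

open Real MeasureTheory Set

/-- `f` is integrable on `s` with integral `v`. -/
def HasInt (f : ℝ → ℝ) (s : Set ℝ) (v : ℝ) : Prop :=
  IntegrableOn f s ∧ ∫ x in s, f x = v

lemma HasInt.add {f g : ℝ → ℝ} {s : Set ℝ} {u v : ℝ} (hf : HasInt f s u) (hg : HasInt g s v) :
    HasInt (fun x => f x + g x) s (u + v) :=
  ⟨hf.1.add hg.1, by rw [integral_add hf.1 hg.1, hf.2, hg.2]⟩

lemma HasInt.sub {f g : ℝ → ℝ} {s : Set ℝ} {u v : ℝ} (hf : HasInt f s u) (hg : HasInt g s v) :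
    HasInt (fun x => f x - g x) s (u - v) :=
  ⟨hf.1.sub hg.1, by rw [integral_sub hf.1 hg.1, hf.2, hg.2]⟩

lemma HasInt.cmul {f : ℝ → ℝ} {s : Set ℝ} {u : ℝ} (c : ℝ) (hf : HasInt f s u) :
    HasInt (fun x => c * f x) s (c * u) :=
  ⟨hf.1.const_mul c, by rw [integral_const_mul, hf.2]⟩

lemma HasInt.congr {f g : ℝ → ℝ} {s : Set ℝ} {u : ℝ} (hs : MeasurableSet s) (hf : HasInt f s u)
    (h : ∀ x ∈ s, g x = f x) : HasInt g s u :=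
  ⟨hf.1.congr_fun (fun x hx => (h x hx).symm) hs, by rw [setIntegral_congr_fun hs h, hf.2]⟩

lemma hasInt_exp {a : ℝ} (ha : a < 0) (c : ℝ) :
    HasInt (fun x => exp (a * x)) (Ioi c) (- exp (a * c) / a) :=
  ⟨integrableOn_exp_mul_Ioi ha c, integral_exp_mul_Ioi ha c⟩

lemma hasInt_id_exp {a : ℝ} (ha : 0 < a) :
    HasInt (fun x => x * exp (-(a * x))) (Ioi 0) (1 / a ^ 2) := by
  constructor
  · have := integrableOn_rpow_mul_exp_neg_mul_rpow (p := 1) (s := 1) (by norm_num) one_pos ha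
    simpa using this
  · have := Real.integral_rpow_mul_exp_neg_mul_Ioi (a := 2) (r := a) (by norm_num) ha
    have e : (2:ℝ) - 1 = 1 := by norm_num
    simp only [e, rpow_one] at this
    rw [this]
    simp

lemma int_exp {c : ℝ} (hc : c ≠ 0) (u v : ℝ) :
    ∫ y in u..v, exp (c * y) = (exp (c * v) - exp (c * u)) / c := by
  rw [intervalIntegral.integral_comp_mul_left (fun y => exp y) hc, integral_exp, smul_eq_mul]
  field_simp

lemma hasInt_cone (p q a c : ℝ) (hp : 0 < a - p * c) (hq : 0 < a - q * c) :
    HasInt (fun x => exp (-(a * x)) * ∫ y in (p * x)..(q * x), exp (c * y)) (Ioi 0)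
      ((q - p) / ((a - p * c) * (a - q * c))) := by
  by_cases hc : c = 0
  · subst hc
    have ha : 0 < a := by simpa using hp
    have := ((hasInt_id_exp ha).cmul (q - p)).congr (g := fun x => exp (-(a * x)) *
      ∫ y in (p * x)..(q * x), exp (0 * y)) measurableSet_Ioi (fun x _ => by simp; ring)
    convert this using 1
    field_simp
    simp
    ring
  · have h := (((hasInt_exp (a := -(a - q * c)) (by linarith) 0).sub
      (hasInt_exp (a := -(a - p * c)) (by linarith) 0)).cmul (1 / c)).congr
      (g := fun x => exp (-(a * x)) *
      ∫ y in (p * x)..(q * x), exp (c * y)) measurableSet_Ioi (fun x _ => by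
        rw [int_exp hc]
        rw [show -(a - q * c) * x = -(a * x) + c * (q * x) by ring,
          show -(a - p * c) * x = -(a * x) + c * (p * x) by ring, exp_add, exp_add]
        ring)
    convert h using 1
    simp only [mul_zero, exp_zero]
    have := hp.ne'
    have := hq.ne'
    field_simp
    ring

lemma hasInt_split {g : ℝ → ℝ} {a b v : ℝ} (hab : a ≤ b) {k : ℝ → ℝ} (hk : Continuous k)
    (hgk : ∀ y, a < y → y < b → g y = k y) (hg : HasInt g (Ioi b) v) :
    HasInt g (Ioi a) ((∫ y in a..b, k y) + v) := by
  have h1 : HasInt g (Ioc a b) (∫ y in a..b, k y) := by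
    have h0 : HasInt k (Ioo a b) (∫ y in a..b, k y) :=
      ⟨(hk.integrableOn_Icc (a := a) (b := b)).mono_set Ioo_subset_Icc_self, by
        rw [intervalIntegral.integral_of_le hab, integral_Ioc_eq_integral_Ioo]⟩
    have h2 := h0.congr (g := g) measurableSet_Ioo (fun y hy => hgk y hy.1 hy.2)
    exact ⟨(integrableOn_Ioc_iff_integrableOn_Ioo (by simp)).2 h2.1, by
      rw [integral_Ioc_eq_integral_Ioo, h2.2]⟩
  rw [← Ioc_union_Ioi_eq_Ioi hab]
  refine ⟨h1.1.union hg.1, ?_⟩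
  rw [setIntegral_union Ioc_disjoint_Ioi_same measurableSet_Ioi h1.1 hg.1, h1.2, hg.2]

/-- **Equation (23).**  Connection failure probability for cell-size dependent RIS
deployment at fraction `f` of the cell radius. -/
theorem connection_failure_cell_size_deployment
    (lb f Rb Rs : ℝ) (hlb : 0 < lb) (hf0 : 0 < f) (hf1 : f < 1)
    (hRb : 0 < Rb) (hRs : 0 < Rs)
    (T1 T2 : ℝ) (hT1 : T1 = lb / Rb) (hT2 : T2 = lb / Rs)
    (J : ℝ → ℝ → ℝ)
    (hJ : ∀ x s, J x s = if x ≤ s then (1 - exp (-T1 * x)) * (1 - exp (-T2 * (s - x)))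
      else 1 - exp (-T2 * (x - s)))
    (fnn : ℝ → ℝ → ℝ)
    (hfnn : ∀ y x, fnn y x = if y < 2 * x then lb * exp (-lb * y)
      else 2 * lb * exp (-2 * lb * (y - x))) :
    (∫ x in Ioi (0:ℝ), (∫ y in Ioi (0:ℝ), J x (f * y / 2) * fnn y x)
        * (2 * lb * exp (-2 * lb * x)))
      = (f - 1) * (f - 2) / (2 * (4 * Rs + 1 - f))
        + f ^ 3 / (2 * (4 * Rb + f) * (4 * Rs + f))
        + 2 * Rs / ((4 * Rs + 1 - f) * (2 * Rs + 1)) := by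
  have hT2p : 0 < T2 := by rw [hT2]; positivity
  have hT1p : 0 < T1 := by rw [hT1]; positivity
  -- the inner integral
  have inner : ∀ x ∈ Ioi (0:ℝ), (∫ y in Ioi (0:ℝ), J x (f * y / 2) * fnn y x)
        * (2 * lb * exp (-2 * lb * x)) =
      2 * lb ^ 2 * (exp (-((2 * lb) * x)) * ∫ y in (0 * x)..(2 * x), exp (-lb * y))
      - 2 * lb ^ 2 * (exp (-((T2 + 2 * lb) * x))
          * ∫ y in (0 * x)..(2 * x), exp ((T2 * f / 2 - lb) * y))
      + 4 * lb ^ 2 * (exp (-(0 * x)) * ∫ y in (2 * x)..(2 / f * x), exp (-2 * lb * y))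
      - 4 * lb ^ 2 * (exp (-(T2 * x))
          * ∫ y in (2 * x)..(2 / f * x), exp ((T2 * f / 2 - 2 * lb) * y))
      + (1 - 4 * lb / (4 * lb + T2 * f)) * (2 * lb) *
        (exp (-(4 * lb / f) * x) - exp (-(4 * lb / f + T1) * x)) := by
    intro x hx
    have hx : 0 < x := hx
    have hfx : 2 * x ≤ 2 / f * x := by
      apply mul_le_mul_of_nonneg_right _ hx.le
      rw [le_div_iff₀ hf0]; linarith
    have key : ∀ y, f * y / 2 < x ↔ y < 2 / f * x := by
      intro y
      rw [div_mul_eq_mul_div, lt_div_iff₀ hf0]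
      constructor <;> intro h <;> linarith
    have r3 : HasInt (fun y => J x (f * y / 2) * fnn y x) (Ioi (2 / f * x))
        ((1 - exp (-T1 * x)) * (2 * lb * exp (2 * lb * x))
          * (-exp (-2 * lb * (2 / f * x)) / (-2 * lb) - exp (T2 * x)
            * (-exp (-(2 * lb + T2 * f / 2) * (2 / f * x)) / (-(2 * lb + T2 * f / 2))))) := by
      refine (((hasInt_exp (a := -2 * lb) (by linarith) _).sub
        ((hasInt_exp (a := -(2 * lb + T2 * f / 2)) (by nlinarith) _).cmul
          (exp (T2 * x)))).cmul _).congr measurableSet_Ioi ?_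
      intro y hy
      have hy : 2 / f * x < y := hy
      have h1 : x ≤ f * y / 2 := by
        by_contra h
        push Not at h
        exact absurd ((key y).1 h) (not_lt.2 hy.le)
      rw [hJ, hfnn, if_pos h1, if_neg (by linarith)]
      rw [show -T2 * (f * y / 2 - x) = T2 * x + -(T2 * f / 2 * y) by ring,
        show -2 * lb * (y - x) = 2 * lb * x + -2 * lb * y by ring,
        show -(2 * lb + T2 * f / 2) * y = -2 * lb * y + -(T2 * f / 2 * y) by ring]
      simp only [exp_add]
      ring
    have r2 := hasInt_split hfx
      (k := fun y => 2 * lb * exp (2 * lb * x) * exp (-2 * lb * y)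
        - 2 * lb * exp ((2 * lb - T2) * x) * exp ((T2 * f / 2 - 2 * lb) * y))
      (by fun_prop) (by
        intro y h1 h2
        rw [hJ, hfnn, if_neg (not_le.2 ((key y).2 h2)), if_neg (by linarith)]
        rw [show -T2 * (x - f * y / 2) = - (T2 * x) + T2 * f / 2 * y by ring,
          show -2 * lb * (y - x) = 2 * lb * x + -2 * lb * y by ring,
          show (2 * lb - T2) * x = 2 * lb * x + - (T2 * x) by ring,
          show (T2 * f / 2 - 2 * lb) * y = T2 * f / 2 * y + -2 * lb * y by ring]
        simp only [exp_add]
        ring) r3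
    have r1 := hasInt_split (a := 0) (b := 2 * x) (by linarith)
      (k := fun y => lb * exp (-lb * y)
        - lb * exp (-(T2 * x)) * exp ((T2 * f / 2 - lb) * y))
      (by fun_prop) (by
        intro y h1 h2
        rw [hJ, hfnn, if_neg (not_le.2 ((key y).2 (by linarith))), if_pos h2]
        rw [show -T2 * (x - f * y / 2) = - (T2 * x) + T2 * f / 2 * y by ring,
          show (T2 * f / 2 - lb) * y = T2 * f / 2 * y + -lb * y by ring]
        simp only [exp_add]
        ring) r2
    rw [r1.2]
    have ci : ∀ c a u v : ℝ, IntervalIntegrable (fun y => a * exp (c * y)) volume u v :=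
      fun c a u v => Continuous.intervalIntegrable (by fun_prop) _ _
    rw [intervalIntegral.integral_sub (ci _ _ _ _) (ci _ _ _ _),
      intervalIntegral.integral_sub (ci _ _ _ _) (ci _ _ _ _)]
    simp only [intervalIntegral.integral_const_mul, zero_mul]
    generalize (∫ y in (0:ℝ)..(2 * x), exp (-lb * y)) = I1
    generalize (∫ y in (0:ℝ)..(2 * x), exp ((T2 * f / 2 - lb) * y)) = I2
    generalize (∫ y in (2 * x)..(2 / f * x), exp (-2 * lb * y)) = I3
    generalize (∫ y in (2 * x)..(2 / f * x), exp ((T2 * f / 2 - 2 * lb) * y)) = I4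
    have e1 : -(2 * lb + T2 * f / 2) * (2 / f * x) = -(4 * lb / f * x) + -(T2 * x) := by
      field_simp; ring
    have e2 : -2 * lb * (2 / f * x) = -(4 * lb / f * x) := by ring
    rw [e1, e2, show (2 * lb - T2) * x = 2 * lb * x + -(T2 * x) by ring,
      show -((T2 + 2 * lb) * x) = -(2 * lb * x) + -(T2 * x) by ring,
      show -2 * lb * x = -(2 * lb * x) by ring,
      show -(4 * lb / f + T1) * x = -(4 * lb / f * x) + -(T1 * x) by ring,
      show -(4 * lb / f) * x = -(4 * lb / f * x) by ring,
      show -T1 * x = -(T1 * x) by ring]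
    simp only [exp_add, exp_neg, neg_zero, zero_mul, exp_zero]
    have p1 := exp_ne_zero (2 * lb * x)
    have p2 := exp_ne_zero (T2 * x)
    have p3 := exp_ne_zero (T1 * x)
    have p4 := exp_ne_zero (4 * lb / f * x)
    generalize exp (2 * lb * x) = A at *
    generalize exp (T2 * x) = B at *
    generalize exp (T1 * x) = C at *
    generalize exp (4 * lb / f * x) = D at *
    have d1 : 4 * lb + T2 * f ≠ 0 := by positivity
    have d2 : 2 * lb + T2 * f / 2 ≠ 0 := by positivity
    have d3 : -(2 * lb + T2 * f / 2) ≠ 0 := neg_ne_zero.2 d2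
    have d4 : 1 / (-(2 * lb + T2 * f / 2)) = - (2 / (4 * lb + T2 * f)) := by
      field_simp
      ring
    have d5 : ∀ z : ℝ, z / (-(2 * lb + T2 * f / 2)) = - (z * (2 / (4 * lb + T2 * f))) := by
      intro z
      rw [div_eq_mul_one_div, d4]; ring
    rw [d5]
    field_simp
    ring
  rw [setIntegral_congr_fun measurableSet_Ioi inner]
  have hfT : 0 < T2 * (1 - f) := mul_pos hT2p (by linarith)
  have hlf : 0 < lb / f := by positivity
  have c1 := hasInt_cone 0 2 (2 * lb) (-lb) (by linarith) (by linarith)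
  have c2 := hasInt_cone 0 2 (T2 + 2 * lb) (T2 * f / 2 - lb) (by linarith) (by linarith)
  have q3 : 0 - 2 / f * (-2 * lb) = 4 * (lb / f) := by ring
  have q4 : T2 - 2 / f * (T2 * f / 2 - 2 * lb) = 4 * (lb / f) := by field_simp; ring
  have c3 := hasInt_cone 2 (2 / f) 0 (-2 * lb) (by linarith) (by rw [q3]; linarith)
  have c4 := hasInt_cone 2 (2 / f) T2 (T2 * f / 2 - 2 * lb) (by linarith) (by rw [q4]; linarith)
  rw [q3] at c3
  rw [q4] at c4
  have n1 : 0 < 4 * lb / f := by positivity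
  have c5 := hasInt_exp (a := -(4 * lb / f)) (by linarith) 0
  have c6 := hasInt_exp (a := -(4 * lb / f + T1)) (by linarith) 0
  have tot := (((((c1.cmul (2 * lb ^ 2)).sub (c2.cmul (2 * lb ^ 2))).add
    (c3.cmul (4 * lb ^ 2))).sub (c4.cmul (4 * lb ^ 2))).add
    ((c5.sub c6).cmul ((1 - 4 * lb / (4 * lb + T2 * f)) * (2 * lb))))
  refine tot.2.trans ?_
  simp only [mul_zero, exp_zero]
  have hD : 0 < 4 * Rs + 1 - f := by linarith
  have hRbf : 0 < 4 * Rb + f := by linarith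
  have hRsf : 0 < 4 * Rs + f := by linarith
  have v1 : 2 * lb ^ 2 * ((2 - 0) / ((2 * lb - 0 * -lb) * (2 * lb - 2 * -lb))) = 1 / 2 := by
    rw [show 2 * lb - 0 * -lb = 2 * lb by ring, show 2 * lb - 2 * -lb = 4 * lb by ring]
    field_simp; ring
  have v2 : 2 * lb ^ 2 * ((2 - 0) / ((T2 + 2 * lb - 0 * (T2 * f / 2 - lb)) *
      (T2 + 2 * lb - 2 * (T2 * f / 2 - lb)))) =
      4 * Rs ^ 2 / ((2 * Rs + 1) * (4 * Rs + 1 - f)) := by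
    rw [show T2 + 2 * lb - 0 * (T2 * f / 2 - lb) = lb / Rs * (2 * Rs + 1) by
        rw [hT2]; field_simp; ring,
      show T2 + 2 * lb - 2 * (T2 * f / 2 - lb) = lb / Rs * (4 * Rs + 1 - f) by
        rw [hT2]; field_simp; ring]
    field_simp; ring
  have v3 : 4 * lb ^ 2 * ((2 / f - 2) / ((0 - 2 * (-2 * lb)) * (4 * (lb / f)))) =
      (1 - f) / 2 := by
    rw [show 0 - 2 * (-2 * lb) = 4 * lb by ring]
    field_simp; ring
  have v4 : 4 * lb ^ 2 * ((2 / f - 2) / ((T2 - 2 * (T2 * f / 2 - 2 * lb)) * (4 * (lb / f)))) =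
      2 * Rs * (1 - f) / (4 * Rs + 1 - f) := by
    rw [show T2 - 2 * (T2 * f / 2 - 2 * lb) = lb / Rs * (4 * Rs + 1 - f) by
        rw [hT2]; field_simp; ring]
    field_simp
  have v5 : (1 - 4 * lb / (4 * lb + T2 * f)) * (2 * lb) *
      (-1 / -(4 * lb / f) - -1 / -(4 * lb / f + T1)) =
      f ^ 3 / (2 * (4 * Rb + f) * (4 * Rs + f)) := by
    rw [show 4 * lb + T2 * f = lb / Rs * (4 * Rs + f) by rw [hT2]; field_simp,
      show 4 * lb / f + T1 = lb / (Rb * f) * (4 * Rb + f) by rw [hT1]; field_simp]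
    field_simp; ring
  rw [v1, v2, v3, v4, v5]
  field_simp
  ring
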